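/- Let A and H be Hopf algebras over a field k with H cocommutative, and let (A, ▷) be a left H-module bialgebra. Then the tensor product coalgebra A ⊗ H, equipped with the two multiplications (a ⊗ x)(b ⊗ y) = a(x₍₁₎ ▷ b) ⊗ x₍₂₎y (the smash product multiplication) and (a ⊗ x) ∘ (b ⊗ y) = ab ⊗ yx, is a Hopf brace; it is cocommutative if A is cocommutative. -/

import Mathlib

/-! Common definitions for formalizing "Constructing Hopf braces" (Agore). -/

open TensorProduct LinearMap

namespace HopfBraceNL

universe u

variable (k : Type u) [Field k]

section HopfStr

variable (V : Type u) [AddCommGroup V] [Module k V] [Coalgebra k V]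

/-- The coalgebra `V` is cocommutative. -/
def IsCocomm : Prop :=
  (TensorProduct.comm k V V).toLinearMap ∘ₗ (Coalgebra.comul (R := k) (A := V)) =
    Coalgebra.comul (R := k) (A := V)

/-- A Hopf algebra structure on the underlying coalgebra of `V`: a multiplication, unit and
antipode making `V` a Hopf algebra whose comultiplication and counit are the given ones. -/
structure HopfStr where
  mul : V ⊗[k] V →ₗ[k] V
  one : V
  mul_assoc : ∀ a b c : V, mul (mul (a ⊗ₜ[k] b) ⊗ₜ[k] c) = mul (a ⊗ₜ[k] mul (b ⊗ₜ[k] c))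
  one_mul : ∀ a : V, mul (one ⊗ₜ[k] a) = a
  mul_one : ∀ a : V, mul (a ⊗ₜ[k] one) = a
  comul_mul : ∀ a b : V,
    Coalgebra.comul (R := k) (mul (a ⊗ₜ[k] b)) =
      TensorProduct.map mul mul
        (TensorProduct.tensorTensorTensorComm k V V V V
          (Coalgebra.comul (R := k) a ⊗ₜ[k] Coalgebra.comul (R := k) b))
  counit_mul : ∀ a b : V,
    Coalgebra.counit (R := k) (mul (a ⊗ₜ[k] b)) =
      Coalgebra.counit (R := k) a * Coalgebra.counit (R := k) b
  comul_one : Coalgebra.comul (R := k) one = one ⊗ₜ[k] one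
  counit_one : Coalgebra.counit (R := k) one = 1
  antipode : V →ₗ[k] V
  antipode_left :
    mul ∘ₗ rTensor V antipode ∘ₗ Coalgebra.comul =
      toSpanSingleton k V one ∘ₗ Coalgebra.counit
  antipode_right :
    mul ∘ₗ lTensor V antipode ∘ₗ Coalgebra.comul =
      toSpanSingleton k V one ∘ₗ Coalgebra.counit

variable {k V}

/-- The Hopf structure is commutative. -/
def HopfStr.IsComm (hs : HopfStr k V) : Prop :=
  ∀ x y : V, hs.mul (x ⊗ₜ[k] y) = hs.mul (y ⊗ₜ[k] x)

/-- The linear map `x ⊗ y ⊗ z ↦ (x₍₁₎ ∘ y)·S(x₍₂₎)·(x₍₃₎ ∘ z)` (Sweedler notation), the right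
hand side of the Hopf brace compatibility condition, written point-free.  Here `m` and `S` are
the multiplication and antipode of the first Hopf structure and `m'` the multiplication of the
second one. -/
noncomputable def braceRHS (m : V ⊗[k] V →ₗ[k] V) (S : V →ₗ[k] V)
    (m' : V ⊗[k] V →ₗ[k] V) : V ⊗[k] (V ⊗[k] V) →ₗ[k] V :=
  m ∘ₗ lTensor V m
    ∘ₗ TensorProduct.map m' (TensorProduct.map S m')
    ∘ₗ lTensor (V ⊗[k] V) (TensorProduct.assoc k V V V).toLinearMap
    ∘ₗ (TensorProduct.tensorTensorTensorComm k V (V ⊗[k] V) V V).toLinearMap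
    ∘ₗ rTensor (V ⊗[k] V)
        ((lTensor V (Coalgebra.comul (R := k))) ∘ₗ (Coalgebra.comul (R := k) (A := V)))

variable (k V) in
/-- A Hopf brace on the coalgebra `V`: two Hopf algebra structures subject to the compatibility
`x ∘ (y·z) = (x₍₁₎ ∘ y)·S(x₍₂₎)·(x₍₃₎ ∘ z)`. -/
structure HopfBrace where
  dot : HopfStr k V
  circ : HopfStr k V
  brace : circ.mul ∘ₗ lTensor V dot.mul = braceRHS dot.mul dot.antipode circ.mul

/-- A solution of the braid equation on `V ⊗ V`. -/
def SolvesBraid {W : Type u} [AddCommGroup W] [Module k W]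
    (c : W ⊗[k] W →ₗ[k] W ⊗[k] W) : Prop :=
  letI c₁ : (W ⊗[k] W) ⊗[k] W →ₗ[k] (W ⊗[k] W) ⊗[k] W := rTensor W c
  letI c₂ : (W ⊗[k] W) ⊗[k] W →ₗ[k] (W ⊗[k] W) ⊗[k] W :=
    (TensorProduct.assoc k W W W).symm.toLinearMap ∘ₗ lTensor W c ∘ₗ
      (TensorProduct.assoc k W W W).toLinearMap
  c₁ ∘ₗ c₂ ∘ₗ c₁ = c₂ ∘ₗ c₁ ∘ₗ c₂

end HopfStr

section Actions

variable {k}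
variable {A H : Type u}
  [AddCommGroup A] [Module k A] [Coalgebra k A]
  [AddCommGroup H] [Module k H] [Coalgebra k H]

/-- `(x, a) ↦ (x₍₁₎ ⊗ a₍₁₎) ⊗ (x₍₂₎ ⊗ a₍₂₎)`, as an element. -/
noncomputable def split (x : H) (a : A) : (H ⊗[k] A) ⊗[k] (H ⊗[k] A) :=
  TensorProduct.tensorTensorTensorComm k H H A A
    (Coalgebra.comul (R := k) x ⊗ₜ[k] Coalgebra.comul (R := k) a)

/-- `A` is a left module over the Hopf structure `hH` via `act`. -/
structure IsLeftModule (hH : HopfStr k H) (act : H ⊗[k] A →ₗ[k] A) : Prop where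
  one_act : ∀ a : A, act (hH.one ⊗ₜ[k] a) = a
  mul_act : ∀ (x y : H) (a : A),
    act (hH.mul (x ⊗ₜ[k] y) ⊗ₜ[k] a) = act (x ⊗ₜ[k] act (y ⊗ₜ[k] a))

/-- `A` is a left module over `hH`-op via `act`, i.e. `(xy) ▶ a = y ▶ (x ▶ a)`. -/
structure IsLeftOpModule (hH : HopfStr k H) (act : H ⊗[k] A →ₗ[k] A) : Prop where
  one_act : ∀ a : A, act (hH.one ⊗ₜ[k] a) = a
  mul_act : ∀ (x y : H) (a : A),
    act (hH.mul (x ⊗ₜ[k] y) ⊗ₜ[k] a) = act (y ⊗ₜ[k] act (x ⊗ₜ[k] a))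

/-- The measuring conditions: `x ▶ (ab) = (x₍₁₎ ▶ a)(x₍₂₎ ▶ b)` and `x ▶ 1 = ε(x)1`. -/
structure IsModuleAlgebraLaw (hA : HopfStr k A) (act : H ⊗[k] A →ₗ[k] A) : Prop where
  act_mul : ∀ (x : H) (a b : A),
    act (x ⊗ₜ[k] hA.mul (a ⊗ₜ[k] b)) =
      hA.mul (TensorProduct.map act act
        (TensorProduct.tensorTensorTensorComm k H H A A
          (Coalgebra.comul (R := k) x ⊗ₜ[k] (a ⊗ₜ[k] b))))
  act_one : ∀ x : H, act (x ⊗ₜ[k] hA.one) = Coalgebra.counit (R := k) x • hA.one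

/-- `act` is a coalgebra map: `Δ(x ▶ a) = (x₍₁₎ ▶ a₍₁₎) ⊗ (x₍₂₎ ▶ a₍₂₎)`,
`ε(x ▶ a) = ε(x)ε(a)`. -/
structure IsCoalgebraLaw (act : H ⊗[k] A →ₗ[k] A) : Prop where
  comul_act : ∀ (x : H) (a : A),
    Coalgebra.comul (R := k) (act (x ⊗ₜ[k] a)) = TensorProduct.map act act (split x a)
  counit_act : ∀ (x : H) (a : A),
    Coalgebra.counit (R := k) (act (x ⊗ₜ[k] a)) =
      Coalgebra.counit (R := k) x * Coalgebra.counit (R := k) a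

/-- `(A, act)` is a left `hH`-module algebra. -/
structure IsLeftModuleAlgebra (hH : HopfStr k H) (hA : HopfStr k A)
    (act : H ⊗[k] A →ₗ[k] A) : Prop where
  toIsLeftModule : IsLeftModule hH act
  toLaw : IsModuleAlgebraLaw hA act

/-- `(A, act)` is a left `hH`-module coalgebra. -/
structure IsLeftModuleCoalgebra (hH : HopfStr k H) (act : H ⊗[k] A →ₗ[k] A) : Prop where
  toIsLeftModule : IsLeftModule hH act
  toCoalgLaw : IsCoalgebraLaw act

/-- `(A, act)` is a left `hH`-module bialgebra. -/
structure IsLeftModuleBialgebra (hH : HopfStr k H) (hA : HopfStr k A)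
    (act : H ⊗[k] A →ₗ[k] A) : Prop where
  toIsLeftModule : IsLeftModule hH act
  toLaw : IsModuleAlgebraLaw hA act
  toCoalgLaw : IsCoalgebraLaw act

/-- `(A, act)` is a left `hH`-op-module bialgebra. -/
structure IsLeftOpModuleBialgebra (hH : HopfStr k H) (hA : HopfStr k A)
    (act : H ⊗[k] A →ₗ[k] A) : Prop where
  toIsLeftOpModule : IsLeftOpModule hH act
  toLaw : IsModuleAlgebraLaw hA act
  toCoalgLaw : IsCoalgebraLaw act

/-- `H` is a right module over the Hopf structure `hA` via `ract : H ⊗ A → H`. -/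
structure IsRightModule (hA : HopfStr k A) (ract : H ⊗[k] A →ₗ[k] H) : Prop where
  act_one : ∀ x : H, ract (x ⊗ₜ[k] hA.one) = x
  act_mul : ∀ (x : H) (a b : A),
    ract (x ⊗ₜ[k] hA.mul (a ⊗ₜ[k] b)) = ract (ract (x ⊗ₜ[k] a) ⊗ₜ[k] b)

/-- `ract` is a coalgebra map `H ⊗ A → H`. -/
structure IsRightCoalgebraLaw (ract : H ⊗[k] A →ₗ[k] H) : Prop where
  comul_act : ∀ (x : H) (a : A),
    Coalgebra.comul (R := k) (ract (x ⊗ₜ[k] a)) = TensorProduct.map ract ract (split x a)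
  counit_act : ∀ (x : H) (a : A),
    Coalgebra.counit (R := k) (ract (x ⊗ₜ[k] a)) =
      Coalgebra.counit (R := k) x * Coalgebra.counit (R := k) a

/-- `(H, ract)` is a right `hA`-module bialgebra:  in addition to the module and coalgebra
conditions, `(xy) ◁ a = (x ◁ a₍₁₎)(y ◁ a₍₂₎)` and `1 ◁ a = ε(a)1`. -/
structure IsRightModuleBialgebra (hA : HopfStr k A) (hH : HopfStr k H)
    (ract : H ⊗[k] A →ₗ[k] H) : Prop where
  toIsRightModule : IsRightModule hA ract
  mul_ract : ∀ (x y : H) (a : A),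
    ract (hH.mul (x ⊗ₜ[k] y) ⊗ₜ[k] a) =
      hH.mul (TensorProduct.map ract ract
        (TensorProduct.tensorTensorTensorComm k H H A A
          ((x ⊗ₜ[k] y) ⊗ₜ[k] Coalgebra.comul (R := k) a)))
  one_ract : ∀ a : A, ract (hH.one ⊗ₜ[k] a) = Coalgebra.counit (R := k) a • hH.one
  toCoalgLaw : IsRightCoalgebraLaw ract

/-- `(A, H, tri, quad)` is a matched pair of Hopf algebras. -/
structure IsMatchedPair (hA : HopfStr k A) (hH : HopfStr k H)
    (tri : H ⊗[k] A →ₗ[k] A) (quad : H ⊗[k] A →ₗ[k] H) : Prop where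
  tri_module : IsLeftModule hH tri
  tri_coalg : IsCoalgebraLaw tri
  quad_module : IsRightModule hA quad
  quad_coalg : IsRightCoalgebraLaw quad
  mp1 : ∀ x : H, tri (x ⊗ₜ[k] hA.one) = Coalgebra.counit (R := k) x • hA.one
  mp1' : ∀ a : A, quad (hH.one ⊗ₜ[k] a) = Coalgebra.counit (R := k) a • hH.one
  mp2 : ∀ (x : H) (a b : A),
    tri (x ⊗ₜ[k] hA.mul (a ⊗ₜ[k] b)) =
      hA.mul (lTensor A tri (TensorProduct.assoc k A H A
        ((TensorProduct.map tri quad (split x a)) ⊗ₜ[k] b)))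
  mp3 : ∀ (x y : H) (a : A),
    quad (hH.mul (x ⊗ₜ[k] y) ⊗ₜ[k] a) =
      hH.mul (rTensor H quad ((TensorProduct.assoc k H A H).symm
        (x ⊗ₜ[k] TensorProduct.map tri quad (split y a))))
  mp4 : ∀ (x : H) (a : A),
    TensorProduct.map quad tri (split x a) =
      TensorProduct.comm k A H (TensorProduct.map tri quad (split x a))

variable (k) in
/-- `(a ⊗ (u₁ ⊗ u₂)) ⊗ y ↦ mA (a ⊗ u₁) ⊗ mH (u₂ ⊗ y)`: the standard way to assemble
a multiplication on `A ⊗ H` from a middle term `u ∈ A ⊗ H`. -/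
noncomputable def sandwich (mA : A ⊗[k] A →ₗ[k] A) (mH : H ⊗[k] H →ₗ[k] H) :
    (A ⊗[k] (A ⊗[k] H)) ⊗[k] H →ₗ[k] A ⊗[k] H :=
  TensorProduct.map mA mH
    ∘ₗ (TensorProduct.assoc k (A ⊗[k] A) H H).toLinearMap
    ∘ₗ rTensor H (TensorProduct.assoc k A A H).symm.toLinearMap

variable (k) in
/-- `(m ⊗ n) ⊗ p ↦ (m ⊗ p) ⊗ n`. -/
noncomputable def rightComm (M N P : Type u) [AddCommGroup M] [Module k M]
    [AddCommGroup N] [Module k N] [AddCommGroup P] [Module k P] :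
    (M ⊗[k] N) ⊗[k] P →ₗ[k] (M ⊗[k] P) ⊗[k] N :=
  (TensorProduct.assoc k M P N).symm.toLinearMap
    ∘ₗ lTensor M (TensorProduct.comm k N P).toLinearMap
    ∘ₗ (TensorProduct.assoc k M N P).toLinearMap

/-- `(x, b) ↦ (x₍₁₎ ▷ b₍₁₎) ⊗ (x₍₂₎ ◁ b₍₂₎)`. -/
noncomputable def matchedEl (tri : H ⊗[k] A →ₗ[k] A) (quad : H ⊗[k] A →ₗ[k] H)
    (x : H) (b : A) : A ⊗[k] H :=
  TensorProduct.map tri quad (split x b)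

/-- `(x, b) ↦ (x₍₁₎ ▷ b) ⊗ x₍₂₎`. -/
noncomputable def smashEl (tri : H ⊗[k] A →ₗ[k] A) (x : H) (b : A) : A ⊗[k] H :=
  rTensor H tri (rightComm k H H A (Coalgebra.comul (R := k) x ⊗ₜ[k] b))

/-- `(x, b) ↦ b₍₁₎ ⊗ (x ◁ b₍₂₎)`. -/
noncomputable def rsmashEl (ract : H ⊗[k] A →ₗ[k] H) (x : H) (b : A) : A ⊗[k] H :=
  lTensor A ract (TensorProduct.leftComm k H A A (x ⊗ₜ[k] Coalgebra.comul (R := k) b))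

end Actions


section SmashProduct

variable {k : Type u} [Field k] {A H : Type u}
  [AddCommGroup A] [Module k A] [Coalgebra k A] [AddCommGroup H] [Module k H] [Coalgebra k H]

theorem HopfStr.mul_antipode_left {V : Type u} [AddCommGroup V] [Module k V] [Coalgebra k V]
    (h : HopfStr k V) (x : V) :
    h.mul (rTensor V h.antipode (Coalgebra.comul (R := k) x)) =
      Coalgebra.counit (R := k) x • h.one :=
  LinearMap.congr_fun h.antipode_left x

theorem HopfStr.mul_antipode_right {V : Type u} [AddCommGroup V] [Module k V] [Coalgebra k V]
    (h : HopfStr k V) (x : V) :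
    h.mul (lTensor V h.antipode (Coalgebra.comul (R := k) x)) =
      Coalgebra.counit (R := k) x • h.one :=
  LinearMap.congr_fun h.antipode_right x

theorem comul_tmul_eq (a : A) (x : H) :
    Coalgebra.comul (R := k) (a ⊗ₜ[k] x) =
      TensorProduct.tensorTensorTensorComm k A A H H
        (Coalgebra.comul (R := k) a ⊗ₜ[k] Coalgebra.comul (R := k) x) := rfl

theorem IsCocomm.comm_comul (h : IsCocomm k H) (x : H) :
    TensorProduct.comm k H H (Coalgebra.comul (R := k) x) = Coalgebra.comul (R := k) x :=
  LinearMap.congr_fun h x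

theorem IsCocomm.tensorTensorTensorComm_comul (h : IsCocomm k H) (x : H) :
    TensorProduct.tensorTensorTensorComm k H H H H
        (TensorProduct.map Coalgebra.comul Coalgebra.comul (Coalgebra.comul (R := k) x)) =
      TensorProduct.map Coalgebra.comul Coalgebra.comul (Coalgebra.comul (R := k) x) := by
  have : Coalgebra.IsCocomm k H := ⟨h⟩
  exact (LinearMap.congr_fun
    (Coalgebra.comulCoalgHom k H).map_comp_comul x).symm

theorem IsCocomm.tensorProduct (hA : IsCocomm k A) (hH : IsCocomm k H) :
    IsCocomm k (A ⊗[k] H) := by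
  have : Coalgebra.IsCocomm k A := ⟨hA⟩
  have : Coalgebra.IsCocomm k H := ⟨hH⟩
  exact Coalgebra.IsCocomm.comm_comp_comul

/-- `p ↦ a (p ▷ b)`. -/
noncomputable def mulAct (mA : A ⊗[k] A →ₗ[k] A) (tri : H ⊗[k] A →ₗ[k] A) (a b : A) : H →ₗ[k] A :=
  mA ∘ₗ TensorProduct.mk k A A a ∘ₗ tri ∘ₗ (TensorProduct.mk k H A).flip b

/-- `q ↦ q y`. -/
noncomputable def mulRight (mH : H ⊗[k] H →ₗ[k] H) (y : H) : H →ₗ[k] H :=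
  mH ∘ₗ (TensorProduct.mk k H H).flip y

@[simp] theorem mulAct_apply (mA : A ⊗[k] A →ₗ[k] A) (tri : H ⊗[k] A →ₗ[k] A) (a b : A) (p : H) :
    mulAct mA tri a b p = mA (a ⊗ₜ[k] tri (p ⊗ₜ[k] b)) := rfl

@[simp] theorem mulRight_apply (mH : H ⊗[k] H →ₗ[k] H) (y q : H) :
    mulRight mH y q = mH (q ⊗ₜ[k] y) := rfl

/-- The smash product multiplication `(a ⊗ x) ⊗ (b ⊗ y) ↦ a (x₍₁₎ ▷ b) ⊗ x₍₂₎ y`. -/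
noncomputable def smashMul (mA : A ⊗[k] A →ₗ[k] A) (mH : H ⊗[k] H →ₗ[k] H)
    (tri : H ⊗[k] A →ₗ[k] A) : (A ⊗[k] H) ⊗[k] (A ⊗[k] H) →ₗ[k] A ⊗[k] H :=
  sandwich k mA mH
    ∘ₗ rTensor H (lTensor A
        (rTensor H tri ∘ₗ rightComm k H H A ∘ₗ rTensor A (Coalgebra.comul (R := k))))
    ∘ₗ rTensor H (TensorProduct.assoc k A H A).toLinearMap
    ∘ₗ (TensorProduct.assoc k (A ⊗[k] H) A H).symm.toLinearMap

theorem smashMul_eq_sandwich (mA : A ⊗[k] A →ₗ[k] A) (mH : H ⊗[k] H →ₗ[k] H)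
    (tri : H ⊗[k] A →ₗ[k] A) (a b : A) (x y : H) :
    smashMul mA mH tri ((a ⊗ₜ[k] x) ⊗ₜ[k] (b ⊗ₜ[k] y)) =
      sandwich k mA mH ((a ⊗ₜ[k] smashEl tri x b) ⊗ₜ[k] y) := rfl

theorem smashMul_tmul (mA : A ⊗[k] A →ₗ[k] A) (mH : H ⊗[k] H →ₗ[k] H)
    (tri : H ⊗[k] A →ₗ[k] A) (a b : A) (x y : H) :
    smashMul mA mH tri ((a ⊗ₜ[k] x) ⊗ₜ[k] (b ⊗ₜ[k] y)) =
      TensorProduct.map (mulAct mA tri a b) (mulRight mH y) (Coalgebra.comul (R := k) x) := by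
  rw [smashMul_eq_sandwich, smashEl]
  induction Coalgebra.comul (R := k) x using TensorProduct.induction_on with
  | zero => simp
  | tmul p q => rfl
  | add u v hu hv => simp only [add_tmul, tmul_add, map_add, hu, hv]

variable {hA : HopfStr k A} {hH : HopfStr k H} {tri : H ⊗[k] A →ₗ[k] A}

theorem smashMul_assoc_tmul (hmb : IsLeftModuleBialgebra hH hA tri) (a b c : A) (x y z : H) :
    smashMul hA.mul hH.mul tri
        (smashMul hA.mul hH.mul tri ((a ⊗ₜ[k] x) ⊗ₜ[k] (b ⊗ₜ[k] y)) ⊗ₜ[k] (c ⊗ₜ[k] z)) =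
      smashMul hA.mul hH.mul tri
        ((a ⊗ₜ[k] x) ⊗ₜ[k] smashMul hA.mul hH.mul tri ((b ⊗ₜ[k] y) ⊗ₜ[k] (c ⊗ₜ[k] z))) := by
  obtain ⟨S, hy⟩ := TensorProduct.exists_finset (Coalgebra.comul (R := k) y)
  let Φ (i : H × H) : (H ⊗[k] H) ⊗[k] H →ₗ[k] A ⊗[k] H :=
    TensorProduct.map
      (hA.mul ∘ₗ TensorProduct.map (mulAct hA.mul tri a b)
        (tri ∘ₗ (TensorProduct.mk k H A).flip (tri (i.1 ⊗ₜ[k] c))))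
      (mulRight hH.mul (hH.mul (i.2 ⊗ₜ[k] z)))
  have hl (w : H ⊗[k] H) : smashMul hA.mul hH.mul tri
      (TensorProduct.map (mulAct hA.mul tri a b) (mulRight hH.mul y) w ⊗ₜ[k] (c ⊗ₜ[k] z)) =
      ∑ i ∈ S, Φ i ((TensorProduct.assoc k H H H).symm
        (lTensor H (Coalgebra.comul (R := k)) w)) := by
    induction w using TensorProduct.induction_on with
    | zero => simp
    | add u v hu hv => simp only [add_tmul, map_add, hu, hv, Finset.sum_add_distrib]
    | tmul p q =>
      simp only [map_tmul, mulAct_apply, mulRight_apply, smashMul_tmul, hH.comul_mul, hy,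
        lTensor_tmul]
      induction Coalgebra.comul (R := k) q using TensorProduct.induction_on with
      | zero => simp
      | add u v hu hv => simp only [add_tmul, tmul_add, map_add, hu, hv, Finset.sum_add_distrib]
      | tmul q r =>
        simp [Φ, tmul_sum, hH.mul_assoc, hmb.toIsLeftModule.mul_act]
  have hr (i : H × H) (w : H ⊗[k] H) :
      TensorProduct.map (mulAct hA.mul tri a (hA.mul (b ⊗ₜ[k] tri (i.1 ⊗ₜ[k] c))))
        (mulRight hH.mul (hH.mul (i.2 ⊗ₜ[k] z))) w =
      Φ i (rTensor H (Coalgebra.comul (R := k)) w) := by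
    induction w using TensorProduct.induction_on with
    | zero => simp
    | add u v hu hv => simp only [map_add, hu, hv]
    | tmul p q =>
      simp only [map_tmul, mulAct_apply, mulRight_apply, hmb.toLaw.act_mul, rTensor_tmul]
      induction Coalgebra.comul (R := k) p using TensorProduct.induction_on with
      | zero => simp
      | add u v hu hv => simp only [add_tmul, tmul_add, map_add, hu, hv]
      | tmul p r => simp [Φ, hA.mul_assoc]
  rw [smashMul_tmul, hl, smashMul_tmul (a := b), hy]
  simp [tmul_sum, smashMul_tmul, hr]

theorem smashMul_assoc (hmb : IsLeftModuleBialgebra hH hA tri) (X Y Z : A ⊗[k] H) :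
    smashMul hA.mul hH.mul tri (smashMul hA.mul hH.mul tri (X ⊗ₜ[k] Y) ⊗ₜ[k] Z) =
      smashMul hA.mul hH.mul tri (X ⊗ₜ[k] smashMul hA.mul hH.mul tri (Y ⊗ₜ[k] Z)) := by
  induction X using TensorProduct.induction_on with
  | zero => simp
  | add u v hu hv => simp only [add_tmul, map_add, hu, hv]
  | tmul a x =>
  induction Y using TensorProduct.induction_on with
  | zero => simp
  | add u v hu hv => simp only [add_tmul, tmul_add, map_add, hu, hv]
  | tmul b y =>
  induction Z using TensorProduct.induction_on with
  | zero => simp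
  | add u v hu hv => simp only [tmul_add, map_add, hu, hv]
  | tmul c z => exact smashMul_assoc_tmul hmb a b c x y z

/-- The product of `a ⊗ x` with an element of `1 ⊗ H`. -/
theorem smashMul_tmul_one_tmul (hmb : IsLeftModuleBialgebra hH hA tri) (a : A) (x y : H) :
    smashMul hA.mul hH.mul tri ((a ⊗ₜ[k] x) ⊗ₜ[k] (hA.one ⊗ₜ[k] y)) =
      a ⊗ₜ[k] hH.mul (x ⊗ₜ[k] y) := by
  have h (w : H ⊗[k] H) : TensorProduct.map (mulAct hA.mul tri a hA.one) (mulRight hH.mul y) w =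
      TensorProduct.map (toSpanSingleton k A a) (mulRight hH.mul y)
        (rTensor H (Coalgebra.counit (R := k)) w) := by
    induction w using TensorProduct.induction_on with
    | zero => simp
    | tmul p q => simp [hmb.toLaw.act_one, hA.mul_one, smul_tmul']
    | add u v hu hv => simp only [map_add, hu, hv]
  rw [smashMul_tmul, h]
  simp

/-- The product of an element of `A ⊗ 1` with `b ⊗ y`. -/
theorem smashMul_tmul_one_left (hmb : IsLeftModuleBialgebra hH hA tri) (a b : A) (y : H) :
    smashMul hA.mul hH.mul tri ((a ⊗ₜ[k] hH.one) ⊗ₜ[k] (b ⊗ₜ[k] y)) =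
      hA.mul (a ⊗ₜ[k] b) ⊗ₜ[k] y := by
  simp [smashMul_tmul, hH.comul_one, hmb.toIsLeftModule.one_act, hH.one_mul]

theorem smashMul_counit (hmb : IsLeftModuleBialgebra hH hA tri) (a b : A) (x y : H) :
    Coalgebra.counit (R := k)
        (smashMul hA.mul hH.mul tri ((a ⊗ₜ[k] x) ⊗ₜ[k] (b ⊗ₜ[k] y))) =
      Coalgebra.counit (R := k) (a ⊗ₜ[k] x) * Coalgebra.counit (R := k) (b ⊗ₜ[k] y) := by
  have h (w : H ⊗[k] H) : Coalgebra.counit (R := k)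
        (TensorProduct.map (mulAct hA.mul tri a b) (mulRight hH.mul y) w) =
      Coalgebra.counit (R := k) a * Coalgebra.counit (R := k) b * Coalgebra.counit (R := k) y *
      Coalgebra.counit (R := k) (TensorProduct.lid k H (rTensor H (Coalgebra.counit (R := k)) w)) := by
    induction w using TensorProduct.induction_on with
    | zero => simp
    | tmul p q => simp [hmb.toCoalgLaw.counit_act, hA.counit_mul, hH.counit_mul]; ring
    | add u v hu hv => simp only [map_add, hu, hv, mul_add]
  rw [smashMul_tmul, h]
  simp
  ring

theorem smashMul_comul (hmb : IsLeftModuleBialgebra hH hA tri) (hc : IsCocomm k H)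
    (a b : A) (x y : H) :
    Coalgebra.comul (R := k)
        (smashMul hA.mul hH.mul tri ((a ⊗ₜ[k] x) ⊗ₜ[k] (b ⊗ₜ[k] y))) =
      TensorProduct.map (smashMul hA.mul hH.mul tri) (smashMul hA.mul hH.mul tri)
        (TensorProduct.tensorTensorTensorComm k (A ⊗[k] H) (A ⊗[k] H) (A ⊗[k] H) (A ⊗[k] H)
          (Coalgebra.comul (R := k) (a ⊗ₜ[k] x) ⊗ₜ[k] Coalgebra.comul (R := k) (b ⊗ₜ[k] y))) := by
  let Ψ (u : A ⊗[k] A) (v : A ⊗[k] A) (w : H ⊗[k] H) :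
      (H ⊗[k] H) ⊗[k] (H ⊗[k] H) →ₗ[k] (A ⊗[k] H) ⊗[k] (A ⊗[k] H) :=
    (TensorProduct.tensorTensorTensorComm k A A H H).toLinearMap ∘ₗ
      TensorProduct.map
        (TensorProduct.map hA.mul hA.mul ∘ₗ
          (TensorProduct.tensorTensorTensorComm k A A A A).toLinearMap ∘ₗ
          TensorProduct.mk k _ _ u ∘ₗ TensorProduct.map tri tri ∘ₗ
          (TensorProduct.tensorTensorTensorComm k H H A A).toLinearMap ∘ₗ
          (TensorProduct.mk k _ _).flip v)
        (TensorProduct.map hH.mul hH.mul ∘ₗ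
          (TensorProduct.tensorTensorTensorComm k H H H H).toLinearMap ∘ₗ
          (TensorProduct.mk k _ _).flip w)
  have hl (w : H ⊗[k] H) : Coalgebra.comul (R := k)
      (TensorProduct.map (mulAct hA.mul tri a b) (mulRight hH.mul y) w) =
      Ψ (Coalgebra.comul a) (Coalgebra.comul b) (Coalgebra.comul y)
        (TensorProduct.map Coalgebra.comul Coalgebra.comul w) := by
    induction w using TensorProduct.induction_on with
    | zero => simp
    | add u v hu hv => simp only [map_add, hu, hv]
    | tmul p q =>
      simp [Ψ, -TensorProduct.comul_tmul, comul_tmul_eq, hA.comul_mul, hH.comul_mul, hmb.toCoalgLaw.comul_act, split]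
  have hu u₁ u₂ v w : Ψ (u₁ + u₂) v w = Ψ u₁ v w + Ψ u₂ v w := by
    simp only [Ψ, map_add, LinearMap.comp_add, LinearMap.add_comp, map_add_left]
  have hv u v₁ v₂ w : Ψ u (v₁ + v₂) w = Ψ u v₁ w + Ψ u v₂ w := by
    simp only [Ψ, map_add, LinearMap.comp_add, map_add_left]
  have hw u v w₁ w₂ : Ψ u v (w₁ + w₂) = Ψ u v w₁ + Ψ u v w₂ := by
    simp only [Ψ, map_add, LinearMap.comp_add, map_add_right]
  rw [smashMul_tmul, hl, ← hc.tensorTensorTensorComm_comul, comul_tmul_eq, comul_tmul_eq]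
  generalize Coalgebra.comul (R := k) a = u
  generalize Coalgebra.comul (R := k) b = v
  generalize Coalgebra.comul (R := k) y = w
  generalize Coalgebra.comul (R := k) x = t
  induction t using TensorProduct.induction_on with
  | zero => simp
  | add _ _ h₁ h₂ => simp only [add_tmul, tmul_add, map_add, h₁, h₂]
  | tmul x₁ x₂ =>
  induction u using TensorProduct.induction_on with
  | zero => simp [Ψ]
  | add _ _ h₁ h₂ => simp only [add_tmul, tmul_add, map_add, hu, LinearMap.add_apply, h₁, h₂]
  | tmul a₁ a₂ =>
  induction v using TensorProduct.induction_on with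
  | zero => simp [Ψ]
  | add _ _ h₁ h₂ => simp only [add_tmul, tmul_add, map_add, hv, LinearMap.add_apply, h₁, h₂]
  | tmul b₁ b₂ =>
  induction w using TensorProduct.induction_on with
  | zero => simp [Ψ]
  | add _ _ h₁ h₂ => simp only [add_tmul, tmul_add, map_add, hw, LinearMap.add_apply, h₁, h₂]
  | tmul y₁ y₂ =>
  simp only [tensorTensorTensorComm_tmul, map_tmul, smashMul_tmul]
  generalize Coalgebra.comul (R := k) x₁ = t₁
  generalize Coalgebra.comul (R := k) x₂ = t₂
  induction t₁ using TensorProduct.induction_on with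
  | zero => simp
  | add _ _ h₁ h₂ => simp only [add_tmul, tmul_add, map_add, h₁, h₂]
  | tmul p₁ p₂ =>
  induction t₂ using TensorProduct.induction_on with
  | zero => simp
  | add _ _ h₁ h₂ => simp only [add_tmul, tmul_add, map_add, h₁, h₂]
  | tmul q₁ q₂ =>
  simp [Ψ]

/-- `a ⊗ x ↦ (1 ⊗ S x) (S a ⊗ 1)`, the antipode of the smash product. -/
noncomputable def smashAntipode (hA : HopfStr k A) (hH : HopfStr k H) (tri : H ⊗[k] A →ₗ[k] A) :
    A ⊗[k] H →ₗ[k] A ⊗[k] H :=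
  smashMul hA.mul hH.mul tri ∘ₗ
    TensorProduct.map (TensorProduct.mk k A H hA.one ∘ₗ hH.antipode)
      ((TensorProduct.mk k A H).flip hH.one ∘ₗ hA.antipode) ∘ₗ
    (TensorProduct.comm k A H).toLinearMap

@[simp] theorem smashAntipode_tmul (a : A) (x : H) :
    smashAntipode hA hH tri (a ⊗ₜ[k] x) =
      smashMul hA.mul hH.mul tri
        ((hA.one ⊗ₜ[k] hH.antipode x) ⊗ₜ[k] (hA.antipode a ⊗ₜ[k] hH.one)) := rfl

theorem smashMul_smashAntipode_left (hmb : IsLeftModuleBialgebra hH hA tri) (a : A) (x : H) :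
    smashMul hA.mul hH.mul tri (rTensor (A ⊗[k] H) (smashAntipode hA hH tri)
        (Coalgebra.comul (R := k) (a ⊗ₜ[k] x))) =
      Coalgebra.counit (R := k) (a ⊗ₜ[k] x) • (hA.one ⊗ₜ[k] hH.one) := by
  have h (u : A ⊗[k] A) (v : H ⊗[k] H) :
      smashMul hA.mul hH.mul tri (rTensor (A ⊗[k] H) (smashAntipode hA hH tri)
        (TensorProduct.tensorTensorTensorComm k A A H H (u ⊗ₜ[k] v))) =
      smashMul hA.mul hH.mul tri (TensorProduct.map (TensorProduct.mk k A H hA.one)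
        (TensorProduct.mk k A H (hA.mul (rTensor A hA.antipode u)))
          (rTensor H hH.antipode v)) := by
    induction u using TensorProduct.induction_on with
    | zero => simp
    | add _ _ h₁ h₂ => simp only [add_tmul, map_add, map_add_right, LinearMap.add_apply, h₁, h₂]
    | tmul a₁ a₂ =>
    induction v using TensorProduct.induction_on with
    | zero => simp
    | add _ _ h₁ h₂ => simp only [tmul_add, map_add, h₁, h₂]
    | tmul x₁ x₂ =>
    simp only [tensorTensorTensorComm_tmul, rTensor_tmul, smashAntipode_tmul, smashMul_assoc hmb,
      smashMul_tmul_one_left hmb, map_tmul, mk_apply]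
  have h' (v : H ⊗[k] H) :
      smashMul hA.mul hH.mul tri (TensorProduct.map (TensorProduct.mk k A H hA.one)
        (TensorProduct.mk k A H hA.one) v) = hA.one ⊗ₜ[k] hH.mul v := by
    induction v using TensorProduct.induction_on with
    | zero => simp
    | add _ _ h₁ h₂ => simp only [tmul_add, map_add, h₁, h₂]
    | tmul x₁ x₂ => simp only [map_tmul, mk_apply, smashMul_tmul_one_tmul hmb]
  rw [comul_tmul_eq, h, hA.mul_antipode_left, map_smul, map_smul_right, LinearMap.smul_apply,
    map_smul, h', hH.mul_antipode_left]
  simp [smul_smul, mul_comm]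

theorem smashMul_smashAntipode_right (hmb : IsLeftModuleBialgebra hH hA tri) (a : A) (x : H) :
    smashMul hA.mul hH.mul tri (lTensor (A ⊗[k] H) (smashAntipode hA hH tri)
        (Coalgebra.comul (R := k) (a ⊗ₜ[k] x))) =
      Coalgebra.counit (R := k) (a ⊗ₜ[k] x) • (hA.one ⊗ₜ[k] hH.one) := by
  have h (u : A ⊗[k] A) (v : H ⊗[k] H) :
      smashMul hA.mul hH.mul tri (lTensor (A ⊗[k] H) (smashAntipode hA hH tri)
        (TensorProduct.tensorTensorTensorComm k A A H H (u ⊗ₜ[k] v))) =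
      smashMul hA.mul hH.mul tri (TensorProduct.map
        ((TensorProduct.mk k A H).flip (hH.mul (lTensor H hH.antipode v)))
        ((TensorProduct.mk k A H).flip hH.one) (lTensor A hA.antipode u)) := by
    induction u using TensorProduct.induction_on with
    | zero => simp
    | add _ _ h₁ h₂ => simp only [add_tmul, map_add, h₁, h₂]
    | tmul a₁ a₂ =>
    induction v using TensorProduct.induction_on with
    | zero => simp
    | add _ _ h₁ h₂ => simp only [tmul_add, map_add, map_add_left, LinearMap.add_apply, h₁, h₂]
    | tmul x₁ x₂ =>
    simp only [tensorTensorTensorComm_tmul, lTensor_tmul, smashAntipode_tmul,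
      ← smashMul_assoc hmb, smashMul_tmul_one_tmul hmb, map_tmul, mk_apply, flip_apply]
  have h' (u : A ⊗[k] A) :
      smashMul hA.mul hH.mul tri (TensorProduct.map ((TensorProduct.mk k A H).flip hH.one)
        ((TensorProduct.mk k A H).flip hH.one) u) = hA.mul u ⊗ₜ[k] hH.one := by
    induction u using TensorProduct.induction_on with
    | zero => simp
    | add _ _ h₁ h₂ => simp only [add_tmul, map_add, h₁, h₂]
    | tmul a₁ a₂ => simp only [map_tmul, mk_apply, flip_apply, smashMul_tmul_one_left hmb]
  rw [comul_tmul_eq, h, hH.mul_antipode_right, map_smul, map_smul_left, LinearMap.smul_apply,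
    map_smul, h', hA.mul_antipode_right]
  simp [smul_smul, smul_tmul']

/-- The smash product Hopf algebra structure on `A ⊗ H`. -/
noncomputable def smashHopfStr (hc : IsCocomm k H) (hmb : IsLeftModuleBialgebra hH hA tri) :
    HopfStr k (A ⊗[k] H) where
  mul := smashMul hA.mul hH.mul tri
  one := hA.one ⊗ₜ[k] hH.one
  mul_assoc := smashMul_assoc hmb
  one_mul X := by
    induction X using TensorProduct.induction_on with
    | zero => simp
    | add _ _ h₁ h₂ => simp only [tmul_add, map_add, h₁, h₂]
    | tmul a x => rw [smashMul_tmul_one_left hmb, hA.one_mul]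
  mul_one X := by
    induction X using TensorProduct.induction_on with
    | zero => simp
    | add _ _ h₁ h₂ => simp only [add_tmul, map_add, h₁, h₂]
    | tmul a x => rw [smashMul_tmul_one_tmul hmb, hH.mul_one]
  comul_mul X Y := by
    induction X using TensorProduct.induction_on with
    | zero => simp
    | add _ _ h₁ h₂ => simp only [add_tmul, map_add, h₁, h₂]
    | tmul a x =>
    induction Y using TensorProduct.induction_on with
    | zero => simp
    | add _ _ h₁ h₂ => simp only [tmul_add, map_add, h₁, h₂]
    | tmul b y => exact smashMul_comul hmb hc a b x y
  counit_mul X Y := by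
    induction X using TensorProduct.induction_on with
    | zero => simp
    | add _ _ h₁ h₂ => simp only [add_tmul, map_add, add_mul, h₁, h₂]
    | tmul a x =>
    induction Y using TensorProduct.induction_on with
    | zero => simp
    | add _ _ h₁ h₂ => simp only [tmul_add, map_add, mul_add, h₁, h₂]
    | tmul b y => exact smashMul_counit hmb a b x y
  comul_one := by simp [comul_tmul_eq, -TensorProduct.comul_tmul, hA.comul_one, hH.comul_one]
  counit_one := by simp [hA.counit_one, hH.counit_one]
  antipode := smashAntipode hA hH tri
  antipode_left := TensorProduct.ext' fun a x => smashMul_smashAntipode_left hmb a x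
  antipode_right := TensorProduct.ext' fun a x => smashMul_smashAntipode_right hmb a x

/-- The opposite of a Hopf algebra structure on a cocommutative coalgebra. -/
noncomputable def HopfStr.op (hc : IsCocomm k H) (hH : HopfStr k H) : HopfStr k H where
  mul := hH.mul ∘ₗ (TensorProduct.comm k H H).toLinearMap
  one := hH.one
  mul_assoc a b c := by simp [hH.mul_assoc]
  one_mul a := by simp [hH.mul_one]
  mul_one a := by simp [hH.one_mul]
  comul_mul a b := by
    simp only [comp_apply, LinearEquiv.coe_coe, comm_tmul, hH.comul_mul]
    induction Coalgebra.comul (R := k) a using TensorProduct.induction_on with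
    | zero => simp
    | add _ _ h₁ h₂ => simp only [add_tmul, tmul_add, map_add, h₁, h₂]
    | tmul a₁ a₂ =>
    induction Coalgebra.comul (R := k) b using TensorProduct.induction_on with
    | zero => simp
    | add _ _ h₁ h₂ => simp only [add_tmul, tmul_add, map_add, h₁, h₂]
    | tmul b₁ b₂ => simp
  counit_mul a b := by simp [hH.counit_mul, mul_comm]
  comul_one := hH.comul_one
  counit_one := hH.counit_one
  antipode := hH.antipode
  antipode_left := by
    ext x
    have h (w : H ⊗[k] H) : TensorProduct.comm k H H (rTensor H hH.antipode w) =
        lTensor H hH.antipode (TensorProduct.comm k H H w) :=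
      (map_comm _ _ w).symm
    simp [h, hc.comm_comul, hH.mul_antipode_right]
  antipode_right := by
    ext x
    have h (w : H ⊗[k] H) : TensorProduct.comm k H H (lTensor H hH.antipode w) =
        rTensor H hH.antipode (TensorProduct.comm k H H w) :=
      (map_comm _ _ w).symm
    simp [h, hc.comm_comul, hH.mul_antipode_left]

/-- The tensor product of two Hopf algebra structures. -/
noncomputable def HopfStr.tensorProduct (hA : HopfStr k A) (hH : HopfStr k H) :
    HopfStr k (A ⊗[k] H) where
  mul := TensorProduct.map hA.mul hH.mul ∘ₗ
    (TensorProduct.tensorTensorTensorComm k A H A H).toLinearMap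
  one := hA.one ⊗ₜ[k] hH.one
  mul_assoc X Y Z := by
    induction X using TensorProduct.induction_on with
    | zero => simp
    | add _ _ h₁ h₂ => simp only [add_tmul, map_add, h₁, h₂]
    | tmul a x =>
    induction Y using TensorProduct.induction_on with
    | zero => simp
    | add _ _ h₁ h₂ => simp only [add_tmul, tmul_add, map_add, h₁, h₂]
    | tmul b y =>
    induction Z using TensorProduct.induction_on with
    | zero => simp
    | add _ _ h₁ h₂ => simp only [tmul_add, map_add, h₁, h₂]
    | tmul c z => simp [hA.mul_assoc, hH.mul_assoc]
  one_mul X := by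
    induction X using TensorProduct.induction_on with
    | zero => simp
    | add _ _ h₁ h₂ => simp only [tmul_add, map_add, h₁, h₂]
    | tmul a x => simp [hA.one_mul, hH.one_mul]
  mul_one X := by
    induction X using TensorProduct.induction_on with
    | zero => simp
    | add _ _ h₁ h₂ => simp only [add_tmul, map_add, h₁, h₂]
    | tmul a x => simp [hA.mul_one, hH.mul_one]
  comul_mul X Y := by
    induction X using TensorProduct.induction_on with
    | zero => simp
    | add _ _ h₁ h₂ => simp only [add_tmul, map_add, h₁, h₂]
    | tmul a x =>
    induction Y using TensorProduct.induction_on with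
    | zero => simp
    | add _ _ h₁ h₂ => simp only [tmul_add, map_add, h₁, h₂]
    | tmul b y =>
    simp only [comp_apply, LinearEquiv.coe_coe, tensorTensorTensorComm_tmul, map_tmul,
      comul_tmul_eq, hA.comul_mul, hH.comul_mul]
    induction Coalgebra.comul (R := k) a using TensorProduct.induction_on with
    | zero => simp
    | add _ _ h₁ h₂ => simp only [add_tmul, map_add, h₁, h₂]
    | tmul a₁ a₂ =>
    induction Coalgebra.comul (R := k) b using TensorProduct.induction_on with
    | zero => simp
    | add _ _ h₁ h₂ => simp only [add_tmul, tmul_add, map_add, h₁, h₂]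
    | tmul b₁ b₂ =>
    induction Coalgebra.comul (R := k) x using TensorProduct.induction_on with
    | zero => simp
    | add _ _ h₁ h₂ => simp only [add_tmul, tmul_add, map_add, h₁, h₂]
    | tmul x₁ x₂ =>
    induction Coalgebra.comul (R := k) y using TensorProduct.induction_on with
    | zero => simp
    | add _ _ h₁ h₂ => simp only [tmul_add, map_add, h₁, h₂]
    | tmul y₁ y₂ => simp
  counit_mul X Y := by
    induction X using TensorProduct.induction_on with
    | zero => simp
    | add _ _ h₁ h₂ => simp only [add_tmul, map_add, add_mul, h₁, h₂]
    | tmul a x =>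
    induction Y using TensorProduct.induction_on with
    | zero => simp
    | add _ _ h₁ h₂ => simp only [tmul_add, map_add, mul_add, h₁, h₂]
    | tmul b y => simp [hA.counit_mul, hH.counit_mul]; ring
  comul_one := by simp [comul_tmul_eq, -TensorProduct.comul_tmul, hA.comul_one, hH.comul_one]
  counit_one := by simp [hA.counit_one, hH.counit_one]
  antipode := TensorProduct.map hA.antipode hH.antipode
  antipode_left := TensorProduct.ext' fun a x => by
    have h (u : A ⊗[k] A) (v : H ⊗[k] H) :
        TensorProduct.map hA.mul hH.mul (TensorProduct.tensorTensorTensorComm k A H A H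
          (rTensor (A ⊗[k] H) (TensorProduct.map hA.antipode hH.antipode)
            (TensorProduct.tensorTensorTensorComm k A A H H (u ⊗ₜ[k] v)))) =
        hA.mul (rTensor A hA.antipode u) ⊗ₜ[k] hH.mul (rTensor H hH.antipode v) := by
      induction u using TensorProduct.induction_on with
      | zero => simp
      | add _ _ h₁ h₂ => simp only [add_tmul, map_add, h₁, h₂]
      | tmul a₁ a₂ =>
      induction v using TensorProduct.induction_on with
      | zero => simp
      | add _ _ h₁ h₂ => simp only [tmul_add, map_add, h₁, h₂]
      | tmul x₁ x₂ => simp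
    simp [comul_tmul_eq, -TensorProduct.comul_tmul, h, hA.mul_antipode_left, hH.mul_antipode_left,
      smul_tmul', smul_smul, mul_comm]
  antipode_right := TensorProduct.ext' fun a x => by
    have h (u : A ⊗[k] A) (v : H ⊗[k] H) :
        TensorProduct.map hA.mul hH.mul (TensorProduct.tensorTensorTensorComm k A H A H
          (lTensor (A ⊗[k] H) (TensorProduct.map hA.antipode hH.antipode)
            (TensorProduct.tensorTensorTensorComm k A A H H (u ⊗ₜ[k] v)))) =
        hA.mul (lTensor A hA.antipode u) ⊗ₜ[k] hH.mul (lTensor H hH.antipode v) := by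
      induction u using TensorProduct.induction_on with
      | zero => simp
      | add _ _ h₁ h₂ => simp only [add_tmul, map_add, h₁, h₂]
      | tmul a₁ a₂ =>
      induction v using TensorProduct.induction_on with
      | zero => simp
      | add _ _ h₁ h₂ => simp only [tmul_add, map_add, h₁, h₂]
      | tmul x₁ x₂ => simp
    simp [comul_tmul_eq, -TensorProduct.comul_tmul, h, hA.mul_antipode_right,
      hH.mul_antipode_right, smul_tmul', smul_smul, mul_comm]

theorem HopfStr.tensorProduct_op_mul_tmul (hc : IsCocomm k H) (a b : A) (x y : H) :
    (hA.tensorProduct (hH.op hc)).mul ((a ⊗ₜ[k] x) ⊗ₜ[k] (b ⊗ₜ[k] y)) =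
      hA.mul (a ⊗ₜ[k] b) ⊗ₜ[k] hH.mul (y ⊗ₜ[k] x) := rfl

theorem tensorProduct_mul_smashMul (hc : IsCocomm k H) (a b c : A) (x y z : H) :
    (hA.tensorProduct (hH.op hc)).mul
        ((a ⊗ₜ[k] x) ⊗ₜ[k] smashMul hA.mul hH.mul tri ((b ⊗ₜ[k] y) ⊗ₜ[k] (c ⊗ₜ[k] z))) =
      smashMul hA.mul hH.mul tri
        ((hA.mul (a ⊗ₜ[k] b) ⊗ₜ[k] y) ⊗ₜ[k] (c ⊗ₜ[k] hH.mul (z ⊗ₜ[k] x))) := by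
  simp only [smashMul_tmul]
  induction Coalgebra.comul (R := k) y using TensorProduct.induction_on with
  | zero => simp
  | add _ _ h₁ h₂ => simp only [tmul_add, map_add, h₁, h₂]
  | tmul y₁ y₂ =>
    simp [HopfStr.tensorProduct_op_mul_tmul, hA.mul_assoc, hH.mul_assoc]

theorem braceRHS_smash (hc : IsCocomm k H) (hmb : IsLeftModuleBialgebra hH hA tri)
    (a b c : A) (x y z : H) :
    braceRHS (smashMul hA.mul hH.mul tri) (smashAntipode hA hH tri)
        (hA.tensorProduct (hH.op hc)).mul ((a ⊗ₜ[k] x) ⊗ₜ[k] ((b ⊗ₜ[k] y) ⊗ₜ[k] (c ⊗ₜ[k] z))) =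
      smashMul hA.mul hH.mul tri
        ((hA.mul (a ⊗ₜ[k] b) ⊗ₜ[k] y) ⊗ₜ[k] (c ⊗ₜ[k] hH.mul (z ⊗ₜ[k] x))) := by
  let G : (A ⊗[k] H) ⊗[k] ((A ⊗[k] H) ⊗[k] (A ⊗[k] H)) →ₗ[k] A ⊗[k] H :=
    smashMul hA.mul hH.mul tri ∘ₗ TensorProduct.map
      ((hA.tensorProduct (hH.op hc)).mul ∘ₗ (TensorProduct.mk k _ _).flip (b ⊗ₜ[k] y))
      (smashMul hA.mul hH.mul tri ∘ₗ TensorProduct.map (smashAntipode hA hH tri)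
        ((hA.tensorProduct (hH.op hc)).mul ∘ₗ (TensorProduct.mk k _ _).flip (c ⊗ₜ[k] z)))
  let Q : A →ₗ[k] (H ⊗[k] H) ⊗[k] H →ₗ[k] A ⊗[k] H := LinearMap.mk₂ k
    (fun a w => smashMul hA.mul hH.mul tri (TensorProduct.map
      (TensorProduct.mk k A H (hA.mul (a ⊗ₜ[k] b)) ∘ₗ hH.mul ∘ₗ
        TensorProduct.map (hH.mul ∘ₗ TensorProduct.mk k H H y) hH.antipode)
      (TensorProduct.mk k A H c ∘ₗ hH.mul ∘ₗ TensorProduct.mk k H H z) w))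
    (fun _ _ _ => by simp only [add_tmul, map_add, LinearMap.add_comp, map_add_left,
      LinearMap.add_apply])
    (fun _ _ _ => by simp only [← smul_tmul', map_smul, LinearMap.smul_comp, map_smul_left,
      LinearMap.smul_apply])
    (fun _ _ _ => by simp only [map_add])
    (fun _ _ _ => by simp only [map_smul])
  have hQ (a : A) (p q r : H) : Q a ((p ⊗ₜ[k] q) ⊗ₜ[k] r) = smashMul hA.mul hH.mul tri
      ((hA.mul (a ⊗ₜ[k] b) ⊗ₜ[k] hH.mul (hH.mul (y ⊗ₜ[k] p) ⊗ₜ[k] hH.antipode q)) ⊗ₜ[k]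
        (c ⊗ₜ[k] hH.mul (z ⊗ₜ[k] r))) := rfl
  have hG (a₁ : A) (x₁ : H) (u : A ⊗[k] A) (v : H ⊗[k] H) :
      G ((a₁ ⊗ₜ[k] x₁) ⊗ₜ[k] TensorProduct.tensorTensorTensorComm k A A H H (u ⊗ₜ[k] v)) =
      smashMul hA.mul hH.mul tri (TensorProduct.map
        (TensorProduct.mk k A H (hA.mul (a₁ ⊗ₜ[k] b)) ∘ₗ hH.mul ∘ₗ
          TensorProduct.map (hH.mul ∘ₗ TensorProduct.mk k H H y) hH.antipode)
        (TensorProduct.mk k A H (hA.mul (hA.mul (rTensor A hA.antipode u) ⊗ₜ[k] c)) ∘ₗ hH.mul ∘ₗ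
          TensorProduct.mk k H H z) ((TensorProduct.assoc k H H H).symm (x₁ ⊗ₜ[k] v))) := by
    induction u using TensorProduct.induction_on with
    | zero => simp
    | add _ _ h₁ h₂ =>
      simp only [add_tmul, tmul_add, map_add, LinearMap.add_comp, map_add_right,
        LinearMap.add_apply, h₁, h₂]
    | tmul a₂ a₃ =>
    induction v using TensorProduct.induction_on with
    | zero => simp
    | add _ _ h₁ h₂ => simp only [tmul_add, map_add, h₁, h₂]
    | tmul x₂ x₃ =>
      simp only [G, comp_apply, map_tmul, tensorTensorTensorComm_tmul, flip_apply, mk_apply,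
        HopfStr.tensorProduct_op_mul_tmul, smashAntipode_tmul, smashMul_assoc hmb,
        smashMul_tmul_one_left hmb, assoc_symm_tmul, rTensor_tmul]
      rw [← smashMul_assoc hmb, smashMul_tmul_one_tmul hmb, hA.mul_assoc]
  have hG' (u : A ⊗[k] A) (v : H ⊗[k] H) :
      G (lTensor (A ⊗[k] H) (Coalgebra.comul (R := k))
        (TensorProduct.tensorTensorTensorComm k A A H H (u ⊗ₜ[k] v))) =
      Q (TensorProduct.rid k A (lTensor A (Coalgebra.counit (R := k)) u))
        ((TensorProduct.assoc k H H H).symm (lTensor H (Coalgebra.comul (R := k)) v)) := by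
    induction u using TensorProduct.induction_on with
    | zero => simp
    | add _ _ h₁ h₂ => simp only [add_tmul, map_add, LinearMap.add_apply, h₁, h₂]
    | tmul a₁ a₂ =>
    induction v using TensorProduct.induction_on with
    | zero => simp
    | add _ _ h₁ h₂ => simp only [tmul_add, map_add, h₁, h₂]
    | tmul x₁ x₂ =>
      simp only [tensorTensorTensorComm_tmul, lTensor_tmul, comul_tmul_eq, hG,
        hA.mul_antipode_left, ← smul_tmul', map_smul, hA.one_mul, LinearMap.smul_comp,
        map_smul_right, LinearMap.smul_apply, rid_tmul]
      rfl
  have hQ' (t : H ⊗[k] H) (q : H) : Q a (t ⊗ₜ[k] q) = smashMul hA.mul hH.mul tri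
      ((hA.mul (a ⊗ₜ[k] b) ⊗ₜ[k] hH.mul (y ⊗ₜ[k] hH.mul (lTensor H hH.antipode t))) ⊗ₜ[k]
        (c ⊗ₜ[k] hH.mul (z ⊗ₜ[k] q))) := by
    induction t using TensorProduct.induction_on with
    | zero => simp
    | add _ _ h₁ h₂ => simp only [add_tmul, tmul_add, map_add, h₁, h₂]
    | tmul p r => rw [hQ, hH.mul_assoc, lTensor_tmul]
  have hQ'' (w : H ⊗[k] H) : Q a (rTensor H (Coalgebra.comul (R := k)) w) =
      smashMul hA.mul hH.mul tri ((hA.mul (a ⊗ₜ[k] b) ⊗ₜ[k] y) ⊗ₜ[k] (c ⊗ₜ[k] hH.mul (z ⊗ₜ[k]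
        TensorProduct.lid k H (rTensor H (Coalgebra.counit (R := k)) w)))) := by
    induction w using TensorProduct.induction_on with
    | zero => simp
    | add _ _ h₁ h₂ => simp only [tmul_add, map_add, h₁, h₂]
    | tmul p q =>
      simp only [rTensor_tmul, hQ', hH.mul_antipode_right, tmul_smul, ← smul_tmul', map_smul,
        hH.mul_one, lid_tmul]
  have hbrace (w : (A ⊗[k] H) ⊗[k] ((A ⊗[k] H) ⊗[k] (A ⊗[k] H))) :
      smashMul hA.mul hH.mul tri (lTensor _ (smashMul hA.mul hH.mul tri)
        (TensorProduct.map (hA.tensorProduct (hH.op hc)).mul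
          (TensorProduct.map (smashAntipode hA hH tri) (hA.tensorProduct (hH.op hc)).mul)
          (lTensor _ (TensorProduct.assoc k _ _ _).toLinearMap
            (TensorProduct.tensorTensorTensorComm k _ _ _ _
              (w ⊗ₜ[k] ((b ⊗ₜ[k] y) ⊗ₜ[k] (c ⊗ₜ[k] z))))))) = G w := by
    induction w using TensorProduct.induction_on with
    | zero => simp
    | add _ _ h₁ h₂ => simp only [add_tmul, map_add, h₁, h₂]
    | tmul X W =>
    induction W using TensorProduct.induction_on with
    | zero => simp
    | add _ _ h₁ h₂ => simp only [add_tmul, tmul_add, map_add, h₁, h₂]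
    | tmul Y Z => rfl
  simp only [braceRHS, comp_apply, LinearEquiv.coe_coe, rTensor_tmul]
  rw [hbrace, comul_tmul_eq, hG', Coalgebra.coassoc_symm_apply, Coalgebra.lTensor_counit_comul, rid_tmul,
    one_smul, hQ'', Coalgebra.rTensor_counit_comul, lid_tmul, one_smul]

/-- The Hopf brace on `A ⊗ H` given by the smash product and by `A ⊗ Hᵒᵖ`. -/
noncomputable def smashHopfBrace (hc : IsCocomm k H) (hmb : IsLeftModuleBialgebra hH hA tri) :
    HopfBrace k (A ⊗[k] H) where
  dot := smashHopfStr hc hmb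
  circ := hA.tensorProduct (hH.op hc)
  brace := by
    ext a x b y c z
    exact (tensorProduct_mul_smashMul hc a b c x y z).trans
      (braceRHS_smash hc hmb a b c x y z).symm

end SmashProduct

/-- (Example `gen 1)`). Let `A`, `H` be Hopf algebras with `H` cocommutative and
`(A, ▷)` a left `H`-module bialgebra. Then the tensor product coalgebra `A ⊗ H` with the smash
product multiplication `(a ⊗ x)(b ⊗ y) = a(x₍₁₎ ▷ b) ⊗ x₍₂₎y` and
`(a ⊗ x) ∘ (b ⊗ y) = ab ⊗ yx` is a Hopf brace; it is cocommutative if `A` is cocommutative. -/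
theorem statement7 {k : Type u} [Field k]
    {A H : Type u} [AddCommGroup A] [Module k A] [Coalgebra k A]
    [AddCommGroup H] [Module k H] [Coalgebra k H]
    (hA : HopfStr k A) (hH : HopfStr k H) (hHcocomm : IsCocomm k H)
    (tri : H ⊗[k] A →ₗ[k] A)
    (hmb : IsLeftModuleBialgebra hH hA tri) :
    ∃ B : HopfBrace k (A ⊗[k] H),
      (∀ (a b : A) (x y : H),
        B.dot.mul ((a ⊗ₜ[k] x) ⊗ₜ[k] (b ⊗ₜ[k] y)) =
          sandwich k hA.mul hH.mul ((a ⊗ₜ[k] smashEl tri x b) ⊗ₜ[k] y)) ∧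
      (∀ (a b : A) (x y : H),
        B.circ.mul ((a ⊗ₜ[k] x) ⊗ₜ[k] (b ⊗ₜ[k] y)) =
          hA.mul (a ⊗ₜ[k] b) ⊗ₜ[k] hH.mul (y ⊗ₜ[k] x)) ∧
      (IsCocomm k A → IsCocomm k (A ⊗[k] H)) := by
  exact ⟨smashHopfBrace hHcocomm hmb, fun _ _ _ _ => rfl, fun _ _ _ _ => rfl,
    fun hAcocomm => hAcocomm.tensorProduct hHcocomm⟩

end HopfBraceNL
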